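/- Let n ≥ 1 and let σ, τ be permutations of Fin n, each satisfying ℓ(σ) + ℓ(σ⁻¹ * s) = n − 1 and ℓ(τ) + ℓ(τ⁻¹ * s) = n − 1, where s is the n-cycle i ↦ i + 1 (mod n). Then there exists a sequence of permutations ρ₀ = σ, ρ₁, …, ρ_m = τ with m = n − c(σ⁻¹ * τ), such that every ρ_j satisfies ℓ(ρ_j) + ℓ(ρ_j⁻¹ * s) = n − 1 and consecutive terms differ by a transposition (ρ_j⁻¹ * ρ_{j+1} is a transposition for each j). In particular the path distance between σ and τ within the interval equals their distance n − c(σ⁻¹τ) in the full Cayley graph. -/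

import Mathlib

/-- Minimal number of transpositions whose product is `σ` (0 for the identity);
this is the graph distance from the identity to `σ` in the Cayley graph of the
symmetric group on `Fin n` generated by all transpositions. -/
noncomputable def swapLength (n : ℕ) (σ : Equiv.Perm (Fin n)) : ℕ :=
  sInf {k | ∃ l : List (Equiv.Perm (Fin n)),
    l.length = k ∧ (∀ t ∈ l, t.IsSwap) ∧ l.prod = σ}

/-- Number of orbits of `σ` acting on `Fin n` (fixed points count as orbits). -/
noncomputable def orbitCount (n : ℕ) (σ : Equiv.Perm (Fin n)) : ℕ :=
  Nat.card (MulAction.orbitRel.Quotient (Subgroup.zpowers σ) (Fin n))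

open Equiv Equiv.Perm

namespace IntervalGeo

variable {n : ℕ}

lemma sl_le_of_list (l : List (Perm (Fin n))) (h : ∀ t ∈ l, t.IsSwap) :
    swapLength n l.prod ≤ l.length :=
  Nat.sInf_le ⟨l, rfl, h, rfl⟩

lemma sl_exists (σ : Perm (Fin n)) : ∃ l : List (Perm (Fin n)),
    l.length = swapLength n σ ∧ (∀ t ∈ l, t.IsSwap) ∧ l.prod = σ := by
  have hne : {k | ∃ l : List (Perm (Fin n)),
    l.length = k ∧ (∀ t ∈ l, t.IsSwap) ∧ l.prod = σ}.Nonempty := by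
    obtain ⟨l, hl, hs⟩ := (truncSwapFactors σ).out
    exact ⟨_, l, rfl, hs, hl⟩
  exact Nat.sInf_mem hne

lemma sl_one : swapLength n 1 = 0 := by
  have := sl_le_of_list (n := n) [] (by simp)
  simpa using this

lemma sl_eq_zero {σ : Perm (Fin n)} (h : swapLength n σ = 0) : σ = 1 := by
  obtain ⟨l, hl, _, hp⟩ := sl_exists σ
  rw [h, List.length_eq_zero_iff] at hl
  subst hl
  simpa using hp.symm

lemma sl_mul (σ τ : Perm (Fin n)) :
    swapLength n (σ * τ) ≤ swapLength n σ + swapLength n τ := by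
  obtain ⟨l, hl, hs, hp⟩ := sl_exists σ
  obtain ⟨l', hl', hs', hp'⟩ := sl_exists τ
  have := sl_le_of_list (l ++ l') (by
    intro t ht
    rcases List.mem_append.1 ht with h | h
    · exact hs t h
    · exact hs' t h)
  rw [List.prod_append, hp, hp', List.length_append] at this
  omega

lemma sl_swap {a b : Fin n} (h : a ≠ b) : swapLength n (swap a b) ≤ 1 := by
  have := sl_le_of_list [swap a b] (by
    intro t ht
    rw [List.mem_singleton] at ht
    exact ⟨a, b, h, ht⟩)
  simpa using this

/-- Functions invariant under a permutation. -/
def inv (π : Perm (Fin n)) : Submodule ℚ (Fin n → ℚ) where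
  carrier := {f | ∀ i, f (π i) = f i}
  add_mem' := by
    intro f g hf hg i
    simp [hf i, hg i]
  zero_mem' := by intro i; rfl
  smul_mem' := by
    intro c f hf i
    simp [hf i]

lemma mem_inv {π : Perm (Fin n)} {f : Fin n → ℚ} : f ∈ inv π ↔ ∀ i, f (π i) = f i := Iff.rfl

lemma inv_zpow {π : Perm (Fin n)} {f : Fin n → ℚ} (hf : f ∈ inv π)
    (g : Subgroup.zpowers π) (i : Fin n) : f (g • i) = f i := by
  obtain ⟨_, k, rfl⟩ := g
  change f ((π ^ k) i) = f i
  induction k using Int.induction_on generalizing i with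
  | zero => rfl
  | succ k ih => rw [zpow_add_one, Perm.mul_apply, ih, mem_inv.1 hf]
  | pred k ih =>
    rw [zpow_sub_one, Perm.mul_apply, ih, ← mem_inv.1 hf]
    simp

lemma orbit_finrank (π : Perm (Fin n)) : orbitCount n π = Module.finrank ℚ (inv π) := by
  classical
  have : Fintype (MulAction.orbitRel.Quotient (Subgroup.zpowers π) (Fin n)) := Fintype.ofFinite _
  let e : (MulAction.orbitRel.Quotient (Subgroup.zpowers π) (Fin n) → ℚ) ≃ₗ[ℚ] inv π :=
    { toFun := fun F => ⟨fun i => F (Quotient.mk _ i), by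
        intro i
        apply congrArg F
        apply Quotient.sound
        exact ⟨⟨π, Subgroup.mem_zpowers π⟩, rfl⟩⟩
      invFun := fun f => fun q => Quotient.lift f.1 (by
        rintro a b ⟨g, rfl⟩
        exact inv_zpow f.2 g b) q
      map_add' := fun _ _ => rfl
      map_smul' := fun _ _ => rfl
      left_inv := by
        intro F
        funext q
        induction q using Quotient.inductionOn with
        | h a => rfl
      right_inv := by
        intro f
        rfl }
  rw [← e.finrank_eq, Module.finrank_fintype_fun_eq_card, orbitCount, Nat.card_eq_fintype_card]

lemma orbit_le (π : Perm (Fin n)) : orbitCount n π ≤ n := by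
  rw [orbit_finrank]
  simpa using Submodule.finrank_le (inv π)

lemma orbit_one : orbitCount n 1 = n := by
  rw [orbit_finrank]
  have : inv (1 : Perm (Fin n)) = ⊤ := by
    ext f; simp [mem_inv]
  rw [this]; simp

lemma orbit_mul_swap_le (π : Perm (Fin n)) (a b : Fin n) :
    orbitCount n (π * swap a b) ≤ orbitCount n π + 1 := by
  rw [orbit_finrank, orbit_finrank]
  let φ : (Fin n → ℚ) →ₗ[ℚ] ℚ := 
    (LinearMap.proj a : (Fin n → ℚ) →ₗ[ℚ] ℚ) - (LinearMap.proj b : (Fin n → ℚ) →ₗ[ℚ] ℚ)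
  let ψ := φ.domRestrict (inv (π * swap a b))
  have h1 := LinearMap.finrank_range_add_finrank_ker ψ
  have h2 : Module.finrank ℚ (LinearMap.range ψ) ≤ 1 := by
    simpa using Submodule.finrank_le (LinearMap.range ψ)
  have h3 : Module.finrank ℚ (LinearMap.ker ψ) ≤ Module.finrank ℚ (inv π) := by
    let g : LinearMap.ker ψ →ₗ[ℚ] inv π :=
      LinearMap.codRestrict (inv π)
        ((inv (π * swap a b)).subtype ∘ₗ (LinearMap.ker ψ).subtype) (by
          rintro ⟨⟨f, hf⟩, hk⟩ i
          have hab : f a = f b := sub_eq_zero.1 (LinearMap.mem_ker.1 hk)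
          change f (π i) = f i
          have h4 := mem_inv.1 hf (swap a b i)
          rw [Perm.mul_apply, swap_apply_self] at h4
          rw [h4, swap_apply_def]
          split_ifs <;> simp_all)
    apply LinearMap.finrank_le_finrank_of_injective (f := g)
    intro u v huv
    apply Subtype.ext
    apply Subtype.ext
    have h5 : (g u).1 = (g v).1 := by rw [huv]
    exact h5
  omega

lemma orbit_mul_swap_ge (π : Perm (Fin n)) (x y : Fin n) (h : π x = y) (hxy : x ≠ y) :
    orbitCount n π + 1 ≤ orbitCount n (π * swap x y) := by
  rw [orbit_finrank, orbit_finrank]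
  apply Submodule.finrank_lt_finrank_of_lt
  have hs : ∀ f : Fin n → ℚ, f x = f y → ∀ i, f (swap x y i) = f i := by
    intro f hf i
    rw [swap_apply_def]
    split_ifs <;> simp_all
  refine lt_of_le_of_ne ?_ ?_
  · intro f hf i
    have := mem_inv.1 hf
    rw [Perm.mul_apply, this]
    exact hs f (by rw [← h, this]) i
  · intro he
    have hm : (Pi.single y 1 : Fin n → ℚ) ∈ inv (π * swap x y) := by
      have hy : (π * swap x y) y = y := by simp [h]
      intro i
      by_cases hi : i = y
      · rw [hi, hy]
      · have : (π * swap x y) i ≠ y := by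
          intro h'
          exact hi ((π * swap x y).injective (h'.trans hy.symm))
        rw [Pi.single_eq_of_ne this, Pi.single_eq_of_ne hi]
    rw [← he] at hm
    have := mem_inv.1 hm x
    rw [h, Pi.single_eq_same, Pi.single_eq_of_ne hxy] at this
    norm_num at this

lemma orbit_mul_swap (π : Perm (Fin n)) (x y : Fin n) (h : π x = y) (hxy : x ≠ y) :
    orbitCount n (π * swap x y) = orbitCount n π + 1 :=
  le_antisymm (orbit_mul_swap_le π x y) (orbit_mul_swap_ge π x y h hxy)

lemma list_orbit (l : List (Perm (Fin n))) (h : ∀ t ∈ l, t.IsSwap) :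
    n ≤ orbitCount n l.prod + l.length := by
  induction l using List.reverseRecOn with
  | nil => simp [orbit_one]
  | append_singleton l t ih =>
    obtain ⟨a, b, hab, rfl⟩ := h t (by simp)
    have h1 := ih (fun t ht => h t (by simp [ht]))
    have h2 := orbit_mul_swap_le (l.prod * swap a b) a b
    rw [mul_assoc, swap_mul_self, mul_one] at h2
    simp only [List.prod_append, List.prod_singleton, List.length_append, List.length_singleton]
    omega

lemma exists_move {π : Perm (Fin n)} (h : π ≠ 1) : ∃ x, x ≠ π x := by
  by_contra! hc
  exact h (Equiv.ext fun x => (hc x).symm)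

lemma sl_le_orbit (k : ℕ) : ∀ π : Perm (Fin n), n - orbitCount n π = k → swapLength n π ≤ k := by
  induction k with
  | zero =>
    intro π h
    by_cases h1 : π = 1
    · rw [h1, sl_one]
    · obtain ⟨x, hx⟩ := exists_move h1
      have := orbit_mul_swap π x _ rfl hx
      have := orbit_le (π * swap x (π x))
      omega
  | succ k ih =>
    intro π h
    have h1 : π ≠ 1 := by
      rintro rfl
      rw [orbit_one] at h
      omega
    obtain ⟨x, hx⟩ := exists_move h1
    have h2 := orbit_mul_swap π x _ rfl hx
    have h3 := ih (π * swap x (π x)) (by omega)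
    have h4 := sl_mul (π * swap x (π x)) (swap x (π x))
    rw [mul_assoc, swap_mul_self, mul_one] at h4
    have := sl_swap hx
    omega

lemma sl_add_orbit (π : Perm (Fin n)) : swapLength n π + orbitCount n π = n := by
  have h1 := sl_le_orbit _ π rfl
  have h2 := orbit_le π
  obtain ⟨l, hl, hs, hp⟩ := sl_exists π
  have h3 := list_orbit l hs
  rw [hp] at h3
  omega

lemma sl_split (π : Perm (Fin n)) (x y : Fin n) (h : π x = y) (hxy : x ≠ y) :
    swapLength n (π * swap x y) + 1 = swapLength n π := by
  have h1 := sl_add_orbit π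
  have h2 := sl_add_orbit (π * swap x y)
  have h3 := orbit_mul_swap π x y h hxy
  omega

lemma sl_split_left (π : Perm (Fin n)) (x y : Fin n) (h : π x = y) (hxy : x ≠ y) :
    swapLength n (swap x y * π) + 1 = swapLength n π := by
  have h1 : swap x y * π = π * swap (π⁻¹ x) x := by
    rw [Equiv.mul_swap_eq_swap_mul, h]
    simp
  rw [h1]
  apply sl_split
  · simp
  · intro h'
    apply hxy
    rw [← h]
    exact Perm.inv_eq_iff_eq.1 h'

lemma supp_le (l : List (Perm (Fin n))) (h : ∀ t ∈ l, t.IsSwap) :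
    l.prod.support.card ≤ 2 * l.length := by
  induction l with
  | nil => simp
  | cons t l ih =>
    have h1 := ih (fun t ht => h t (by simp [ht]))
    have h2 := card_support_eq_two.2 (h t (by simp))
    have h3 := Finset.card_le_card (support_mul_le t l.prod)
    have h4 := Finset.card_union_le t.support l.prod.support
    simp only [List.prod_cons, List.length_cons]
    have h5 : (t * l.prod).support.card ≤ (t.support ∪ l.prod.support).card := h3
    omega

lemma supp_le_sl (π : Perm (Fin n)) : π.support.card ≤ 2 * swapLength n π := by
  obtain ⟨l, hl, hs, hp⟩ := sl_exists π
  have := supp_le l hs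
  rw [hp] at this
  omega

lemma sl_lt_supp (k : ℕ) : ∀ π : Perm (Fin n), swapLength n π = k → π ≠ 1 →
    k + 1 ≤ π.support.card := by
  induction k with
  | zero =>
    intro π h h1
    exact absurd (sl_eq_zero h) h1
  | succ k ih =>
    intro π h h1
    obtain ⟨x, hx⟩ := exists_move h1
    have h2 := sl_split π x _ rfl hx
    by_cases h3 : π * swap x (π x) = 1
    · rw [h3, sl_one] at h2
      have h4 : π.support.card ≠ 0 := by
        intro h5; exact h1 (card_support_eq_zero.1 h5)
      have := card_support_ne_one π
      omega
    · have h4 := ih _ (by omega) h3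
      have h5 : (π * swap x (π x)).support ⊂ π.support := by
        rw [Finset.ssubset_iff_of_subset]
        · refine ⟨π x, ?_, ?_⟩
          · rw [mem_support]
            intro h6
            exact hx (π.injective h6).symm
          · simp
        · intro z hz
          rw [mem_support] at hz ⊢
          intro h6
          apply hz
          rw [Perm.mul_apply, swap_apply_def]
          split_ifs with h7 h8
          · subst h7; exact absurd h6.symm hx
          · exact h8.symm
          · exact h6
      have := Finset.card_lt_card h5
      omega

/-- The interval below `s`. -/
def In (s σ : Perm (Fin n)) : Prop :=
  swapLength n σ + swapLength n (σ⁻¹ * s) = swapLength n s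

lemma In_of_le {s σ : Perm (Fin n)}
    (h : swapLength n σ + swapLength n (σ⁻¹ * s) ≤ swapLength n s) : In s σ := by
  have := sl_mul σ (σ⁻¹ * s)
  rw [mul_inv_cancel_left] at this
  exact le_antisymm h this

lemma leaf {s σ : Perm (Fin n)} (h : In s σ) (hs : s ≠ 1) :
    ∃ i, i ≠ s i ∧ (σ i = i ∨ σ i = s i) := by
  by_contra! hc
  have h1 : s.support ⊆ σ.support := by
    intro i hi
    rw [mem_support] at hi ⊢
    exact (hc i hi.symm).1
  have h2 : s.support ⊆ (σ⁻¹ * s).support := by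
    intro i hi
    rw [mem_support] at hi ⊢
    intro h3
    apply (hc i hi.symm).2
    rw [Perm.mul_apply, Perm.inv_eq_iff_eq] at h3
    exact h3.symm
  have h3 := Finset.card_le_card h1
  have h4 := Finset.card_le_card h2
  have h5 := supp_le_sl σ
  have h6 := supp_le_sl (σ⁻¹ * s)
  have h7 := sl_lt_supp _ s rfl hs
  unfold In at h
  omega

/-- Paths within the interval. -/
def Path (s σ τ : Perm (Fin n)) (m : ℕ) : Prop :=
  ∃ ρ : ℕ → Perm (Fin n), ρ 0 = σ ∧ ρ m = τ ∧ (∀ j ≤ m, In s (ρ j)) ∧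
    ∀ j < m, ∃ a b : Fin n, a ≠ b ∧ (ρ j)⁻¹ * ρ (j + 1) = swap a b

lemma Path.snoc {s σ τ : Perm (Fin n)} {m : ℕ} {a b : Fin n} (hab : a ≠ b)
    (h : Path s σ (τ * swap a b) m) (hτ : In s τ) : Path s σ τ (m + 1) := by
  obtain ⟨ρ, h0, hm, hin, hst⟩ := h
  refine ⟨fun j => if j ≤ m then ρ j else τ, by simp [h0], by simp, ?_, ?_⟩
  · intro j hj
    dsimp only
    split_ifs with h1
    · exact hin j h1
    · exact hτ
  · intro j hj
    dsimp only
    rw [if_pos (by omega)]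
    split_ifs with h1
    · exact hst j (by omega)
    · have : j = m := by omega
      subst this
      refine ⟨a, b, hab, ?_⟩
      rw [hm, mul_inv_rev, swap_inv, mul_assoc, inv_mul_cancel, mul_one]

theorem main (N : ℕ) : ∀ s σ τ : Perm (Fin n), swapLength n s + swapLength n (σ⁻¹ * τ) = N →
    In s σ → In s τ → Path s σ τ (swapLength n (σ⁻¹ * τ)) := by
  induction N using Nat.strong_induction_on with
  | _ N ih =>
  intro s σ τ hN hσ hτ
  by_cases hst : σ = τ
  · subst hst
    rw [inv_mul_cancel, sl_one]
    exact ⟨fun _ => σ, rfl, rfl, fun _ _ => hσ, fun j hj => absurd hj (Nat.not_lt_zero j)⟩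
  have hs : s ≠ 1 := by
    rintro rfl
    unfold In at hσ hτ
    rw [sl_one] at hσ hτ
    apply hst
    rw [sl_eq_zero (σ := σ) (by omega), sl_eq_zero (σ := τ) (by omega)]
  obtain ⟨i, hi, hl | hl⟩ := leaf hσ hs
  · by_cases ht : τ i = i
    · -- both fix i
      have hx : s (s⁻¹ i) = i := by simp
      have hne : s⁻¹ i ≠ i := by
        intro h; rw [h] at hx; exact hi hx.symm
      have hs' := sl_split s _ _ hx hne
      have key : ∀ ρ : Perm (Fin n), ρ i = i → In s ρ → In (s * swap (s⁻¹ i) i) ρ := by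
        intro ρ hρ hI
        have h1 := sl_split (ρ⁻¹ * s) (s⁻¹ i) i (by
          rw [Perm.mul_apply, hx, Perm.inv_eq_iff_eq, hρ]) hne
        unfold In at hI ⊢
        rw [← mul_assoc]
        omega
      obtain ⟨ρ, h0, hm, hin, hstp⟩ := ih _ (by omega) (s * swap (s⁻¹ i) i) σ τ rfl
        (key σ hl hσ) (key τ ht hτ)
      refine ⟨ρ, h0, hm, fun j hj => ?_, hstp⟩
      have h1 := hin j hj
      unfold In at h1
      apply In_of_le
      have h2 := sl_mul ((ρ j)⁻¹ * (s * swap (s⁻¹ i) i)) (swap (s⁻¹ i) i)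
      rw [mul_assoc, mul_assoc, swap_mul_self, mul_one] at h2
      have h3 := sl_swap hne
      omega
    · have hy : τ (τ⁻¹ i) = i := by simp
      have hne : τ⁻¹ i ≠ i := by
        intro h; rw [h] at hy; exact ht hy
      have h1 := sl_split τ _ _ hy hne
      have h2 := sl_split (σ⁻¹ * τ) (τ⁻¹ i) i (by
        rw [Perm.mul_apply, hy, Perm.inv_eq_iff_eq, hl]) hne
      have h3 : In s (τ * swap (τ⁻¹ i) i) := by
        apply In_of_le
        rw [mul_inv_rev, swap_inv, mul_assoc]
        have h4 := sl_mul (swap (τ⁻¹ i) i) (τ⁻¹ * s)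
        have h5 := sl_swap hne
        unfold In at hτ
        omega
      rw [← h2]
      rw [mul_assoc] at h2 ⊢
      exact (ih _ (by omega) s σ _ rfl hσ h3).snoc hne hτ
  · by_cases ht : τ i = s i
    · have hs' := sl_split_left s i _ rfl hi
      have key : ∀ ρ : Perm (Fin n), ρ i = s i → In s ρ →
          In (swap i (s i) * s) (swap i (s i) * ρ) := by
        intro ρ hρ hI
        have h1 := sl_split_left ρ i _ hρ hi
        unfold In at hI ⊢
        rw [mul_inv_rev, swap_inv, mul_assoc, swap_mul_self_mul]
        omega
      have he : (swap i (s i) * σ)⁻¹ * (swap i (s i) * τ) = σ⁻¹ * τ := by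
        rw [mul_inv_rev, swap_inv, mul_assoc, swap_mul_self_mul]
      have hp := ih _ (by rw [he]; omega) (swap i (s i) * s) (swap i (s i) * σ)
        (swap i (s i) * τ) rfl (key σ hl hσ) (key τ ht hτ)
      rw [he] at hp
      obtain ⟨ρ, h0, hm, hin, hstp⟩ := hp
      refine ⟨fun j => swap i (s i) * ρ j, by simp [h0], by simp [hm], fun j hj => ?_,
        fun j hj => ?_⟩
      · have h1 := hin j hj
        unfold In at h1
        apply In_of_le
        have h2 := sl_mul (swap i (s i)) (ρ j)
        have h3 := sl_swap hi
        dsimp only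
        rw [mul_inv_rev, swap_inv, mul_assoc]
        omega
      · dsimp only
        rw [mul_inv_rev, swap_inv, mul_assoc, swap_mul_self_mul]
        exact hstp j hj
    · have hy : τ (τ⁻¹ (s i)) = s i := by simp
      have hne : τ⁻¹ (s i) ≠ i := by
        intro h; rw [h] at hy; exact ht hy
      have h1 := sl_split_left (τ⁻¹ * s) i (τ⁻¹ (s i)) rfl hne.symm
      have h2 := sl_split (σ⁻¹ * τ) (τ⁻¹ (s i)) i (by
        rw [Perm.mul_apply, hy, Perm.inv_eq_iff_eq, hl]) hne
      have h3 : In s (τ * swap (τ⁻¹ (s i)) i) := by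
        apply In_of_le
        rw [mul_inv_rev, swap_inv, mul_assoc]
        have h4 := sl_mul τ (swap (τ⁻¹ (s i)) i)
        have h5 := sl_swap hne
        rw [swap_comm] at h1
        unfold In at hτ
        omega
      rw [← h2]
      rw [mul_assoc] at h2 ⊢
      exact (ih _ (by omega) s σ _ rfl hσ h3).snoc hne hτ

lemma sl_rotate (hn : 1 ≤ n) : swapLength n (finRotate n) = n - 1 := by
  have h := sl_add_orbit (finRotate n)
  suffices h1 : orbitCount n (finRotate n) = 1 by omega
  obtain ⟨m, rfl⟩ : ∃ m, n = m + 1 := ⟨n - 1, by omega⟩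
  unfold orbitCount
  rw [Nat.card_eq_one_iff_unique]
  refine ⟨⟨fun a b => ?_⟩, ⟨Quotient.mk _ 0⟩⟩
  have key : ∀ k (hk : k < m + 1), (Quotient.mk _ ⟨k, hk⟩ :
      MulAction.orbitRel.Quotient (Subgroup.zpowers (finRotate (m + 1))) (Fin (m + 1))) =
      Quotient.mk _ 0 := by
    intro k
    induction k with
    | zero => intro hk; rfl
    | succ k ih =>
      intro hk
      rw [← ih (by omega)]
      apply Quotient.sound
      refine ⟨⟨finRotate (m + 1), Subgroup.mem_zpowers _⟩, ?_⟩
      exact finRotate_of_lt (by omega)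
  induction a using Quotient.inductionOn with
  | h a =>
  induction b using Quotient.inductionOn with
  | h b => exact (key a.1 a.2).trans (key b.1 b.2).symm

end IntervalGeo

/-- Any two vertices of the interval from `e` to `s` are joined, inside the
interval, by a path of length `n - c(σ⁻¹τ)` whose consecutive terms differ by a
transposition; hence their path distance within the interval equals their
distance `n - c(σ⁻¹τ)` in the full Cayley graph. -/
theorem interval_geodesic (n : ℕ) (hn : 1 ≤ n) (σ τ : Equiv.Perm (Fin n))
    (hσ : swapLength n σ + swapLength n (σ⁻¹ * finRotate n) = n - 1)
    (hτ : swapLength n τ + swapLength n (τ⁻¹ * finRotate n) = n - 1) :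
    ∃ ρ : ℕ → Equiv.Perm (Fin n),
      ρ 0 = σ ∧
      ρ (n - orbitCount n (σ⁻¹ * τ)) = τ ∧
      (∀ j ≤ n - orbitCount n (σ⁻¹ * τ),
        swapLength n (ρ j) + swapLength n ((ρ j)⁻¹ * finRotate n) = n - 1) ∧
      (∀ j < n - orbitCount n (σ⁻¹ * τ),
        ∃ a b : Fin n, a ≠ b ∧ (ρ j)⁻¹ * ρ (j + 1) = Equiv.swap a b) := by
  have hr := IntervalGeo.sl_rotate hn
  have ho := IntervalGeo.sl_add_orbit (σ⁻¹ * τ)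
  have he : n - orbitCount n (σ⁻¹ * τ) = swapLength n (σ⁻¹ * τ) := by omega
  rw [he, ← hr]
  exact IntervalGeo.main _ (finRotate n) σ τ rfl (by rw [IntervalGeo.In, hr]; exact hσ)
    (by rw [IntervalGeo.In, hr]; exact hτ)
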